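/- Suppose a⁰,a¹ : ℕ → ℂ² satisfy condition (A) and conditions (C1)–(C5), that 0 < ‖a⁰₀‖ < 1, that ⟨a⁰₁, a⁰₀⟩ ≠ 0 and that ⟨a¹₀, a⁰₀⟩ ≠ 0. Then there exist unit vectors u₀,u₁,v ∈ ℂ² with ⟨v,u₀⟩ ≠ 0 and ⟨u₁,u₀⟩ ≠ 0, nonzero complex numbers ρ₀,ρ₁,τ₀,τ₁ and r ∈ ℂ such that: |ρ₀| = ‖a⁰₀‖ (so 0 < |ρ₀| < 1); (|ρ₀|²/(1−|ρ₀|²))·⟨u₀,u₁⟩·⟨v,u₀⟩ + ⟨v,u₁⟩ = 0; r = −(conj(ρ₀)/conj(ρ₁))·⟨v,u₀⟩/(1 + (|ρ₀|²/(1−|ρ₀|²))·|⟨v,u₀⟩|²); |ρ₁|² = (1−|ρ₀|²)/(1 + (|ρ₀|²/(1−|ρ₀|²))·|⟨v,u₀⟩|²); |τ₀|² = 1/(1 + (|ρ₀|²/(1−|ρ₀|²))·|⟨u₁,u₀⟩|²); τ₁ = τ₀·ρ₁·⟨u₁,v⟩/(ρ₀·⟨u₀,v⟩); and a⁰₀ =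 ρ₀·u₀, a⁰_k = ρ₁·r^{k−1}·v for all k ≥ 1, a¹₀ = τ₀·u₁, a¹_k = τ₁·r^{k−1}·v for all k ≥ 1. (That is, the corresponding M⁺-inner matrix function is of Type 5.) -/

import Mathlib

open Finset

/-- `ℂ²` with its Euclidean structure. -/
abbrev E2 := EuclideanSpace ℂ (Fin 2)

/-- The inner product of `ℂ²`: `⟨u,v⟩ = u⁽¹⁾conj(v⁽¹⁾) + u⁽²⁾conj(v⁽²⁾)`. -/
noncomputable def cinner (u v : E2) : ℂ := ∑ i, u i * (starRingEnd ℂ) (v i)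

/-- Condition (A). -/
def condA (a0 a1 : ℕ → E2) : Prop :=
  (∀ m : ℕ, (∑' k : ℕ, cinner (a0 (k + m)) (a0 k)) = if m = 0 then 1 else 0) ∧
  (∀ m : ℕ, (∑' k : ℕ, cinner (a1 (k + m)) (a1 k)) = if m = 0 then 1 else 0) ∧
  (∀ m : ℕ, (∑' k : ℕ, cinner (a0 (k + m)) (a1 k)) = 0) ∧
  (∀ m : ℕ, (∑' k : ℕ, cinner (a1 (k + m)) (a0 k)) = 0)

/-- Conditions (C1)–(C5), with `d := 1 − ‖a0 0‖²`. -/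
def condC (a0 a1 : ℕ → E2) : Prop :=
  (∀ p : ℕ, 1 ≤ p → ‖cinner (a0 p) (a0 0)‖ ^ 2
      = (1 - ‖a0 0‖ ^ 2) * (1 - ∑ k ∈ Finset.range (p + 1), ‖a0 k‖ ^ 2)) ∧
  (∀ p : ℕ, ‖cinner (a1 p) (a0 0)‖ ^ 2
      = (1 - ‖a0 0‖ ^ 2) * (1 - ∑ k ∈ Finset.range (p + 1), ‖a1 k‖ ^ 2)) ∧
  (∀ p p' : ℕ, 0 < p → p < p' →
    cinner (a0 p') (a0 0) * cinner (a0 0) (a0 p)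
      = -((1 - ‖a0 0‖ ^ 2 : ℝ) : ℂ) *
          ∑ r ∈ Finset.range (p + 1), cinner (a0 (p' - r)) (a0 (p - r))) ∧
  (∀ p p' : ℕ, p < p' →
    cinner (a1 p') (a0 0) * cinner (a0 0) (a1 p)
      = -((1 - ‖a0 0‖ ^ 2 : ℝ) : ℂ) *
          ∑ r ∈ Finset.range (p + 1), cinner (a1 (p' - r)) (a1 (p - r))) ∧
  (∀ p p' : ℕ, 0 < p → p ≤ p' →
    cinner (a1 p') (a0 0) * cinner (a0 0) (a0 p)
      = -((1 - ‖a0 0‖ ^ 2 : ℝ) : ℂ) *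
          ∑ r ∈ Finset.range (p + 1), cinner (a1 (p' - r)) (a0 (p - r))) ∧
  (∀ p p' : ℕ, p' < p →
    cinner (a1 p') (a0 0) * cinner (a0 0) (a0 p)
      = -((1 - ‖a0 0‖ ^ 2 : ℝ) : ℂ) *
          ∑ r ∈ Finset.range (p' + 1), cinner (a1 (p' - r)) (a0 (p - r)))

lemma cinner_eq_inner (u v : E2) : cinner u v = inner ℂ v u := by
  simp [cinner, PiLp.inner_apply]

lemma cinner_add_left (x y z : E2) : cinner (x + y) z = cinner x z + cinner y z := by
  simp only [cinner_eq_inner, inner_add_right]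

lemma cinner_add_right (x y z : E2) : cinner x (y + z) = cinner x y + cinner x z := by
  simp only [cinner_eq_inner, inner_add_left]

lemma cinner_smul_left (c : ℂ) (x y : E2) : cinner (c • x) y = c * cinner x y := by
  simp only [cinner_eq_inner, inner_smul_right]

lemma cinner_smul_right (c : ℂ) (x y : E2) :
    cinner x (c • y) = (starRingEnd ℂ) c * cinner x y := by
  simp only [cinner_eq_inner, inner_smul_left]

lemma conj_cinner (x y : E2) : (starRingEnd ℂ) (cinner x y) = cinner y x := by
  simp only [cinner_eq_inner, inner_conj_symm]

lemma cinner_self (x : E2) : cinner x x = (‖x‖ : ℂ) ^ 2 := by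
  rw [cinner_eq_inner, inner_self_eq_norm_sq_to_K]; rfl

lemma norm_cinner_sq (x y : E2) : (‖cinner x y‖ : ℂ) ^ 2 = cinner x y * cinner y x := by
  rw [← conj_cinner x y, Complex.mul_conj']

/-- Two vectors whose Gram matrix for the positive definite form
`⟨x,e⟩⟨e,y⟩ + d⟨x,y⟩` is degenerate are proportional. -/
lemma smul_eq_of_gram_degenerate {d : ℝ} (hd : 0 < d) (e x y : E2) (s : ℂ)
    (hx : ‖cinner x e‖ ^ 2 + d * ‖x‖ ^ 2 = ‖s‖ ^ 2)
    (hy : ‖cinner y e‖ ^ 2 + d * ‖y‖ ^ 2 = d ^ 2)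
    (hxy : cinner x e * cinner e y + d * cinner x y = -d * s) :
    x = (-s / d) • y := by
  have hd' : (d : ℂ) ≠ 0 := by exact_mod_cast hd.ne'
  have hyx := congrArg (starRingEnd ℂ) hxy
  simp only [map_add, map_mul, conj_cinner, Complex.conj_ofReal, map_neg] at hyx
  have hx' : cinner x e * cinner e x + d * cinner x x = s * (starRingEnd ℂ) s := by
    rw [← norm_cinner_sq, cinner_self, Complex.mul_conj']; exact_mod_cast hx
  have hy' : cinner y e * cinner e y + d * cinner y y = d ^ 2 := by
    rw [← norm_cinner_sq, cinner_self]; exact_mod_cast hy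
  have key : ‖cinner ((d : ℂ) • x + s • y) e‖ ^ 2 + d * ‖(d : ℂ) • x + s • y‖ ^ 2 = 0 := by
    have h : (‖cinner ((d : ℂ) • x + s • y) e‖ : ℂ) ^ 2
        + d * (‖(d : ℂ) • x + s • y‖ : ℂ) ^ 2 = 0 := by
      rw [norm_cinner_sq, ← cinner_self]
      simp only [cinner_add_left, cinner_add_right, cinner_smul_left, cinner_smul_right,
        Complex.conj_ofReal]
      linear_combination (d : ℂ) ^ 2 * hx' + s * (starRingEnd ℂ) s * hy'
        + d * (starRingEnd ℂ) s * hxy + d * s * hyx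
    exact_mod_cast h
  have hz : (d : ℂ) • x + s • y = 0 := by
    have h1 := mul_nonneg hd.le (sq_nonneg ‖(d : ℂ) • x + s • y‖)
    have h2 := sq_nonneg ‖cinner ((d : ℂ) • x + s • y) e‖
    have h3 : d * ‖(d : ℂ) • x + s • y‖ ^ 2 = 0 := by linarith
    simpa [hd.ne'] using h3
  have : (d : ℂ) • x = (d : ℂ) • ((-s / d) • y) := by
    rw [smul_smul, mul_div_cancel₀ _ hd', neg_smul]
    exact eq_neg_of_add_eq_zero_left hz
  exact smul_right_injective _ hd' this

lemma eq_norm_smul_normalized {x : E2} (hx : x ≠ 0) :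
    ∃ u : E2, ‖u‖ = 1 ∧ x = (‖x‖ : ℂ) • u := by
  have hn : (‖x‖ : ℂ) ≠ 0 := by simpa using hx
  refine ⟨(‖x‖ : ℂ)⁻¹ • x, ?_, ?_⟩
  · simp [norm_smul, hx]
  · rw [smul_smul, mul_inv_cancel₀ hn, one_smul]

/-- A sequence of vectors, each determined by its predecessor as a multiple of a fixed vector,
is geometric. -/
lemma eq_geometric_smul {d : ℂ} {b : ℕ → E2} {e w : E2} {c : ℂ} (h1 : b 1 = c • w)
    (hb : ∀ k, 1 ≤ k → b (k + 1) = (-cinner (b k) e / d) • w) :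
    ∀ k, 1 ≤ k → b k = (c * (-cinner w e / d) ^ (k - 1)) • w := by
  intro k hk
  induction k, hk using Nat.le_induction with
  | base => simpa using h1
  | succ k hk ih =>
    rw [hb k hk, ih, cinner_smul_left]
    obtain ⟨n, rfl⟩ := Nat.exists_eq_add_of_le' hk
    simp only [Nat.add_sub_cancel]
    congr 1
    ring

theorem stmt16 (a0 a1 : ℕ → E2) (hA : condA a0 a1) (hC : condC a0 a1)
    (h00 : 0 < ‖a0 0‖) (h01 : ‖a0 0‖ < 1)
    (hC2 : cinner (a0 1) (a0 0) ≠ 0) (hC3 : cinner (a1 0) (a0 0) ≠ 0) :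
    ∃ u0 u1 v : E2, ∃ ρ0 ρ1 τ0 τ1 r : ℂ,
      ‖u0‖ = 1 ∧ ‖u1‖ = 1 ∧ ‖v‖ = 1 ∧
      cinner v u0 ≠ 0 ∧ cinner u1 u0 ≠ 0 ∧
      ρ0 ≠ 0 ∧ ρ1 ≠ 0 ∧ τ0 ≠ 0 ∧ τ1 ≠ 0 ∧
      ‖ρ0‖ = ‖a0 0‖ ∧
      ((‖ρ0‖ ^ 2 / (1 - ‖ρ0‖ ^ 2) : ℝ) : ℂ) * cinner u0 u1 * cinner v u0
        + cinner v u1 = 0 ∧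
      r = -((starRingEnd ℂ) ρ0 / (starRingEnd ℂ) ρ1) * cinner v u0 /
        ((1 + ‖ρ0‖ ^ 2 / (1 - ‖ρ0‖ ^ 2) * ‖cinner v u0‖ ^ 2 : ℝ) : ℂ) ∧
      ‖ρ1‖ ^ 2 = (1 - ‖ρ0‖ ^ 2) /
        (1 + ‖ρ0‖ ^ 2 / (1 - ‖ρ0‖ ^ 2) * ‖cinner v u0‖ ^ 2) ∧
      ‖τ0‖ ^ 2 = 1 /
        (1 + ‖ρ0‖ ^ 2 / (1 - ‖ρ0‖ ^ 2) * ‖cinner u1 u0‖ ^ 2) ∧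
      τ1 = τ0 * ρ1 * cinner u1 v / (ρ0 * cinner u0 v) ∧
      a0 0 = ρ0 • u0 ∧ (∀ k : ℕ, 1 ≤ k → a0 k = (ρ1 * r ^ (k - 1)) • v) ∧
      a1 0 = τ0 • u1 ∧ (∀ k : ℕ, 1 ≤ k → a1 k = (τ1 * r ^ (k - 1)) • v) := by
  obtain ⟨c1, c2, c3, -, c5, c5'⟩ := hC
  have hd : 0 < 1 - ‖a0 0‖ ^ 2 := by nlinarith
  obtain ⟨d, hdef⟩ : ∃ d, d = 1 - ‖a0 0‖ ^ 2 := ⟨_, rfl⟩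
  rw [← hdef] at c1 c2 c3 c5 c5' hd
  have hdC : (d : ℂ) ≠ 0 := by exact_mod_cast hd.ne'
  have hy : ‖cinner (a0 1) (a0 0)‖ ^ 2 + d * ‖a0 1‖ ^ 2 = d ^ 2 := by
    have := c1 1 le_rfl
    simp only [sum_range_succ, sum_range_zero] at this
    rw [this, show ‖a0 0‖ ^ 2 = 1 - d by linarith]; ring
  have step0 : ∀ k, 1 ≤ k → a0 (k + 1) = (-cinner (a0 k) (a0 0) / d) • a0 1 := by
    intro k hk
    refine smul_eq_of_gram_degenerate hd (a0 0) _ _ _ ?_ hy ?_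
    · have e1 := c1 (k + 1) (by omega)
      rw [sum_range_succ] at e1
      linear_combination e1 - c1 k hk
    · have e3 := c3 1 (k + 1) one_pos (by omega)
      simp only [sum_range_succ, sum_range_zero, Nat.sub_zero, Nat.add_sub_cancel,
        Nat.sub_self] at e3
      linear_combination e3
  have step1 : ∀ k, a1 (k + 1) = (-cinner (a1 k) (a0 0) / d) • a0 1 := by
    intro k
    refine smul_eq_of_gram_degenerate hd (a0 0) _ _ _ ?_ hy ?_
    · have e1 := c2 (k + 1)
      rw [sum_range_succ] at e1
      linear_combination e1 - c2 k
    · have e3 := c5 1 (k + 1) one_pos (by omega)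
      simp only [sum_range_succ, sum_range_zero, Nat.sub_zero, Nat.add_sub_cancel,
        Nat.sub_self] at e3
      linear_combination e3
  have g0 := eq_geometric_smul (c := 1) (one_smul ℂ (a0 1)).symm step0
  have g1 := eq_geometric_smul (step1 0) (fun k _ => step1 k)
  have horth : cinner (a1 0) (a0 0) * cinner (a0 0) (a0 1) + d * cinner (a1 0) (a0 1) = 0 := by
    have := c5' 1 0 one_pos
    simp only [sum_range_succ, sum_range_zero, Nat.sub_zero] at this
    linear_combination this
  have ht : ‖cinner (a1 0) (a0 0)‖ ^ 2 + d * ‖a1 0‖ ^ 2 = d := by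
    have := c2 0
    simp only [sum_range_succ, sum_range_zero] at this
    linear_combination this
  have ne0 : a0 0 ≠ 0 := norm_pos_iff.mp h00
  have ne1 : a0 1 ≠ 0 := fun h => hC2 (by simp [h, cinner])
  have ne2 : a1 0 ≠ 0 := fun h => hC3 (by simp [h, cinner])
  obtain ⟨u0, hu0, e0⟩ := eq_norm_smul_normalized ne0
  obtain ⟨v, hv, ev⟩ := eq_norm_smul_normalized ne1
  obtain ⟨u1, hu1, e1⟩ := eq_norm_smul_normalized ne2
  have hρ0 : (‖a0 0‖ : ℂ) ≠ 0 := by simpa using ne0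
  have hρ1 : (‖a0 1‖ : ℂ) ≠ 0 := by simpa using ne1
  have hτ0 : (‖a1 0‖ : ℂ) ≠ 0 := by simpa using ne2
  have p1 : 0 < ‖a0 1‖ := norm_pos_iff.mpr ne1
  have p2 : 0 < ‖a1 0‖ := norm_pos_iff.mpr ne2
  have x1 : cinner (a0 1) (a0 0) = ‖a0 1‖ * (‖a0 0‖ * cinner v u0) := by
    conv_lhs => rw [ev, e0]
    simp only [cinner_smul_left, cinner_smul_right, Complex.conj_ofReal]
    ring
  have x1' : cinner (a0 0) (a0 1) = ‖a0 1‖ * (‖a0 0‖ * cinner u0 v) := by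
    conv_lhs => rw [ev, e0]
    simp only [cinner_smul_left, cinner_smul_right, Complex.conj_ofReal]
  have x2 : cinner (a1 0) (a0 0) = ‖a1 0‖ * (‖a0 0‖ * cinner u1 u0) := by
    conv_lhs => rw [e1, e0]
    simp only [cinner_smul_left, cinner_smul_right, Complex.conj_ofReal]
    ring
  have x3 : cinner (a1 0) (a0 1) = ‖a1 0‖ * (‖a0 1‖ * cinner u1 v) := by
    conv_lhs => rw [e1, ev]
    simp only [cinner_smul_left, cinner_smul_right, Complex.conj_ofReal]
    ring
  have hvu : cinner v u0 ≠ 0 := fun h => hC2 (by simp [x1, h])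
  have huv : cinner u0 v ≠ 0 := by
    rw [← conj_cinner]; simpa using hvu
  have huu : cinner u1 u0 ≠ 0 := fun h => hC3 (by simp [x2, h])
  have hy2 : ‖a0 1‖ ^ 2 * (‖a0 0‖ ^ 2 * ‖cinner v u0‖ ^ 2 + d) = d ^ 2 := by
    rw [x1] at hy
    simp only [norm_mul, Complex.norm_real, norm_norm] at hy
    linear_combination hy
  have ht2 : ‖a1 0‖ ^ 2 * (‖a0 0‖ ^ 2 * ‖cinner u1 u0‖ ^ 2 + d) = d := by
    rw [x2] at ht
    simp only [norm_mul, Complex.norm_real, norm_norm] at ht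
    linear_combination ht
  have ho2 : (‖a0 0‖ : ℂ) ^ 2 * cinner u1 u0 * cinner u0 v + d * cinner u1 v = 0 := by
    rw [x1', x2, x3] at horth
    apply mul_left_cancel₀ (mul_ne_zero hτ0 hρ1)
    linear_combination horth
  have ho3 : (‖a0 0‖ : ℂ) ^ 2 * cinner u0 u1 * cinner v u0 + d * cinner v u1 = 0 := by
    have := congrArg (starRingEnd ℂ) ho2
    simpa [conj_cinner] using this
  refine ⟨u0, u1, v, ‖a0 0‖, ‖a0 1‖, ‖a1 0‖, -cinner (a1 0) (a0 0) / d * ‖a0 1‖,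
    -cinner (a0 1) (a0 0) / d, hu0, hu1, hv, hvu, huu, hρ0, hρ1, hτ0, ?_, ?_, ?_, ?_, ?_, ?_,
    ?_, e0, ?_, e1, ?_⟩
  · exact mul_ne_zero (div_ne_zero (neg_ne_zero.mpr hC3) hdC) hρ1
  · simp
  · simp only [Complex.norm_real, norm_norm, ← hdef]
    push_cast
    field_simp
    linear_combination ho3
  · simp only [Complex.norm_real, norm_norm, ← hdef, Complex.conj_ofReal]
    have hz : ((1 + ‖a0 0‖ ^ 2 / d * ‖cinner v u0‖ ^ 2 : ℝ) : ℂ) = d / ‖a0 1‖ ^ 2 := by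
      have : 1 + ‖a0 0‖ ^ 2 / d * ‖cinner v u0‖ ^ 2 = d / ‖a0 1‖ ^ 2 := by
        field_simp
        linear_combination hy2
      rw [this]; push_cast; rfl
    rw [hz, x1]
    field_simp
  · simp only [Complex.norm_real, norm_norm, ← hdef]
    field_simp
    linear_combination hy2
  · simp only [Complex.norm_real, norm_norm, ← hdef]
    field_simp
    linear_combination ht2
  · rw [x2]
    field_simp
    linear_combination -ho2
  · intro k hk
    rw [g0 k hk]
    nth_rewrite 2 [ev]
    rw [smul_smul]
    congr 1
    ring
  · intro k hk
    rw [g1 k hk]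
    nth_rewrite 2 [ev]
    rw [smul_smul]
    congr 1
    ring
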